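/- There exists no 2-dimensional connected Buchsbaum simplicial complex Δ such that β_1(Δ) = 1, β_2(Δ) = 4, and h(Δ) = (1,3,6,3). -/

import Mathlib

open Finset

noncomputable section

/-- `Δ` is a simplicial complex on `[n] = {1,…,n}`: a collection of subsets of `[n]`,
closed under taking subsets, containing every singleton `{i}` for `i ∈ [n]`. -/
def IsComplexOn (n : ℕ) (Δ : Finset (Finset ℕ)) : Prop :=
  (∀ F ∈ Δ, ∀ G ⊆ F, G ∈ Δ) ∧
  (∀ F ∈ Δ, ∀ i ∈ F, i ∈ Finset.Icc 1 n) ∧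
  (∀ i ∈ Finset.Icc 1 n, ({i} : Finset ℕ) ∈ Δ)

/-- a simplicial complex whose vertex set is contained in `[n]`:
a downward closed collection of subsets of `[n]`. -/
def IsComplexIn (n : ℕ) (Δ : Finset (Finset ℕ)) : Prop :=
  (∀ F ∈ Δ, ∀ G ⊆ F, G ∈ Δ) ∧ (∀ F ∈ Δ, ∀ i ∈ F, i ∈ Finset.Icc 1 n)

/-- the faces of `Δ` with `m` vertices -/
def facesOf (Δ : Finset (Finset ℕ)) (m : ℕ) : Finset (Finset ℕ) :=
  Δ.filter fun F => F.card = m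

/-- `fVec Δ j = f_{j-1}(Δ)`, the number of faces of `Δ` with `j` vertices;
by convention `f_{-1}(Δ) = 1`. -/
def fVec (Δ : Finset (Finset ℕ)) (j : ℕ) : ℤ :=
  if j = 0 then 1 else ((facesOf Δ j).card : ℤ)

/-- the `h`-vector of a `(d-1)`-dimensional complex, defined by
`∑ f_{i-1} (x-1)^{d-i} = ∑ h_i x^{d-i}`, i.e.
`h_i = ∑_{j=0}^{i} (-1)^{i-j} C(d-j, i-j) f_{j-1}`. -/
def hVec (d : ℕ) (Δ : Finset (Finset ℕ)) (i : ℕ) : ℤ :=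
  ∑ j ∈ Finset.range (i + 1),
    (-1 : ℤ) ^ (i - j) * ((d - j).choose (i - j) : ℤ) * fVec Δ j

/-- the dimension `max {k : f_k(Δ) ≠ 0}` of `Δ`, as an integer -/
def dimZ (Δ : Finset (Finset ℕ)) : ℤ := ((Δ.sup Finset.card : ℕ) : ℤ) - 1

/-- the link `lk_Δ(F) = {G : G ∩ F = ∅, G ∪ F ∈ Δ}` -/
def link (Δ : Finset (Finset ℕ)) (F : Finset ℕ) : Finset (Finset ℕ) :=
  Δ.filter fun G => Disjoint G F ∧ G ∪ F ∈ Δ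

variable (K : Type) [Field K]

/-- the simplicial boundary operator on formal `K`-linear combinations of
finite subsets of `ℕ` (vertices ordered by the order on `ℕ`):
`∂ F = ∑_{v ∈ F} (-1)^{#{u ∈ F : u < v}} (F \ {v})`. -/
def bdry : (Finset ℕ →₀ K) →ₗ[K] (Finset ℕ →₀ K) :=
  Finsupp.lsum K fun F => LinearMap.toSpanSingleton K (Finset ℕ →₀ K)
    (∑ v ∈ F, ((-1 : K) ^ ((F.filter fun u => u < v).card)) • Finsupp.single (F.erase v) (1 : K))

/-- the space of simplicial `K`-chains of `Δ` spanned by the faces with `m` vertices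
(for `m = 0` this is the span of the empty face, giving *reduced* homology) -/
def chains (Δ : Finset (Finset ℕ)) (m : ℕ) : Submodule K (Finset ℕ →₀ K) :=
  Submodule.span K ((fun F => Finsupp.single F (1 : K)) '' (facesOf Δ m : Set (Finset ℕ)))

/-- the dimension of the reduced homology of `Δ` at faces of cardinality `m`:
`dim (ker ∂ ∩ C_m) - dim (∂ C_{m+1})` -/
def homDim (Δ : Finset (Finset ℕ)) (m : ℕ) : ℕ :=
  Module.finrank K ↥(chains K Δ m ⊓ LinearMap.ker (bdry K))
    - Module.finrank K ↥((chains K Δ (m + 1)).map (bdry K))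

/-- the reduced Betti number `β_i(Δ; K) = dim_K H̃_i(Δ; K)` for `i : ℤ` -/
def betti (Δ : Finset (Finset ℕ)) (i : ℤ) : ℕ :=
  if 0 ≤ i + 1 then homDim K Δ (i + 1).toNat else 0

/-- all facets (maximal faces) of `Δ` have the same cardinality -/
def IsPure (Δ : Finset (Finset ℕ)) : Prop :=
  ∀ F ∈ Δ, (∀ G ∈ Δ, F ⊆ G → F = G) → F.card = Δ.sup Finset.card

/-- `Δ` is Cohen–Macaulay (over `K`): for every face `F ∈ Δ` (including `∅`),
`β_i(lk_Δ(F)) = 0` for all `i ≠ dim Δ - |F|`. -/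
def IsCohenMacaulay (Δ : Finset (Finset ℕ)) : Prop :=
  ∀ F ∈ Δ, ∀ i : ℤ, i ≠ dimZ Δ - F.card → betti K (link Δ F) i = 0

/-- `Δ` is Buchsbaum (over `K`): `Δ` is pure and the link of every vertex is
Cohen–Macaulay. -/
def IsBuchsbaum (Δ : Finset (Finset ℕ)) : Prop :=
  IsPure Δ ∧ ∀ v : ℕ, ({v} : Finset ℕ) ∈ Δ → IsCohenMacaulay K (link Δ {v})

/-- `Δ` is connected: any two vertices are joined by a path of edges of `Δ` -/
def IsConnectedComplex (Δ : Finset (Finset ℕ)) : Prop :=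
  ∀ u v : ℕ, ({u} : Finset ℕ) ∈ Δ → ({v} : Finset ℕ) ∈ Δ →
    Relation.ReflTransGen (fun a b : ℕ => a ≠ b ∧ ({a, b} : Finset ℕ) ∈ Δ) u v

/-- `Δ` is link-acyclic: `β_i(lk_Δ(v)) = 0` for every vertex `v` of `Δ` and every `i` -/
def IsLinkAcyclic (Δ : Finset (Finset ℕ)) : Prop :=
  ∀ v : ℕ, ({v} : Finset ℕ) ∈ Δ → ∀ i : ℤ, betti K (link Δ {v}) i = 0

/-- `Δ` is `2`-dimensional with `h`-vector `(a, b, c, e)` -/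
def hVector3 (Δ : Finset (Finset ℕ)) (a b c e : ℤ) : Prop :=
  hVec 3 Δ 0 = a ∧ hVec 3 Δ 1 = b ∧ hVec 3 Δ 2 = c ∧ hVec 3 Δ 3 = e

/-- `macaulay2 a = a^⟨2⟩`: if `a = C(b,2) + r` is the (greedy) `2`-nd Macaulay
representation (`b` maximal with `C(b,2) ≤ a`, `0 ≤ r < b`, `r = C(r,1)`), then
`a^⟨2⟩ = C(b+1,3) + C(r+1,2)`, and `0^⟨2⟩ = 0`. -/
def macaulay2 (a : ℕ) : ℕ :=
  if a = 0 then 0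
  else
    (Nat.findGreatest (fun t => t.choose 2 ≤ a) (a + 2) + 1).choose 3
      + (a - (Nat.findGreatest (fun t => t.choose 2 ≤ a) (a + 2)).choose 2 + 1).choose 2

/-- `modRep n i = ī`, the unique element of `[n] = {1,…,n}` congruent to `i` mod `n` -/
def modRep (n : ℕ) (i : ℤ) : ℕ := ((i - 1) % (n : ℤ)).toNat + 1


end

theorem bdry_single (K : Type) [Field K] (F : Finset ℕ) :
    bdry K (Finsupp.single F 1) = ∑ v ∈ F, ((-1 : K) ^ ((F.filter fun u => u < v).card)) •
      Finsupp.single (F.erase v) (1 : K) := by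
  simp [bdry]

theorem bdry_singleton (K : Type) [Field K] (a : ℕ) :
    bdry K (Finsupp.single {a} 1) = Finsupp.single ∅ 1 := by
  simp [bdry_single, Finset.filter_singleton]

theorem bdry_pair (K : Type) [Field K] {a b : ℕ} (h : a < b) :
    bdry K (Finsupp.single {a, b} 1) = Finsupp.single {b} 1 - Finsupp.single {a} 1 := by
  have h1 : ({a, b} : Finset ℕ).filter (fun u => u < a) = ∅ := by
    ext u; simp; omega
  have h2 : ({a, b} : Finset ℕ).filter (fun u => u < b) = {a} := by
    ext u; simp; omega
  have e1 : ({a, b} : Finset ℕ).erase a = {b} := by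
    ext u; simp; omega
  have e2 : ({a, b} : Finset ℕ).erase b = {a} := by
    ext u; simp; omega
  rw [bdry_single, Finset.sum_pair h.ne, h1, h2, e1, e2]
  simp [sub_eq_add_neg]

theorem bdry_triple (K : Type) [Field K] {a b c : ℕ} (hab : a < b) (hbc : b < c) :
    bdry K (Finsupp.single {a, b, c} 1) =
      Finsupp.single {b, c} 1 - Finsupp.single {a, c} 1 + Finsupp.single {a, b} 1 := by
  have h1 : ({a, b, c} : Finset ℕ).filter (fun u => u < a) = ∅ := by
    ext u; simp; omega
  have h2 : ({a, b, c} : Finset ℕ).filter (fun u => u < b) = {a} := by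
    ext u; simp; omega
  have h3 : ({a, b, c} : Finset ℕ).filter (fun u => u < c) = {a, b} := by
    ext u; simp; omega
  have e1 : ({a, b, c} : Finset ℕ).erase a = {b, c} := by
    ext u; simp; omega
  have e2 : ({a, b, c} : Finset ℕ).erase b = {a, c} := by
    ext u; simp; omega
  have e3 : ({a, b, c} : Finset ℕ).erase c = {a, b} := by
    ext u; simp; omega
  have ha : a ∉ ({b, c} : Finset ℕ) := by simp; omega
  rw [bdry_single, Finset.sum_insert ha, Finset.sum_pair hbc.ne, h1, h2, h3, e1, e2, e3,
    Finset.card_pair hab.ne]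
  simp only [card_empty, pow_zero, one_smul, card_singleton, pow_one, neg_smul, even_two,
    Even.neg_pow, one_pow]
  abel

/-- The linear functional on chains extending a function on vertices. -/
noncomputable def vertexFunctional (K : Type) [Field K] (p : ℕ → K) : (Finset ℕ →₀ K) →ₗ[K] K :=
  Finsupp.linearCombination K fun s : Finset ℕ => ∑ x ∈ s, p x

theorem vertexFunctional_single (K : Type) [Field K] (p : ℕ → K) (a : ℕ) :
    vertexFunctional K p (Finsupp.single {a} 1) = p a := by
  simp [vertexFunctional]

instance finiteDimensional_chains (K : Type) [Field K] (Δ : Finset (Finset ℕ)) (m : ℕ) :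
    FiniteDimensional K (chains K Δ m) :=
  FiniteDimensional.span_of_finite K ((facesOf Δ m).finite_toSet.image _)

theorem exists_lt_of_mem_facesOf_two {Δ : Finset (Finset ℕ)} {F : Finset ℕ}
    (hF : F ∈ facesOf Δ 2) : ∃ a b : ℕ, a < b ∧ F = {a, b} ∧ {a, b} ∈ Δ := by
  obtain ⟨hF, hc⟩ := Finset.mem_filter.1 hF
  obtain ⟨a, b, hab, rfl⟩ := Finset.card_eq_two.1 hc
  rcases hab.lt_or_gt with h | h
  · exact ⟨a, b, h, rfl, hF⟩
  · exact ⟨b, a, h, Finset.pair_comm a b, Finset.pair_comm a b ▸ hF⟩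

/-- A nonzero first Betti number yields an antisymmetric `1`-cocycle on the complex which is
not a coboundary. -/
theorem exists_cocycle {K : Type} [Field K] {Δ : Finset (Finset ℕ)} (h : betti K Δ 1 ≠ 0) :
    ∃ g : ℕ → ℕ → K, (∀ x, g x x = 0) ∧ (∀ x y, g x y = -g y x) ∧
      (∀ x y z, x ≠ y → y ≠ z → x ≠ z → {x, y, z} ∈ Δ → g x y + g y z + g z x = 0) ∧
      ∀ p : ℕ → K, ∃ x y, {x, y} ∈ Δ ∧ g x y ≠ p y - p x := by
  have h' : Module.finrank K ↥((chains K Δ 3).map (bdry K)) <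
      Module.finrank K ↥(chains K Δ 2 ⊓ LinearMap.ker (bdry K)) := by
    have : homDim K Δ 2 ≠ 0 := by simpa [betti] using h
    exact Nat.sub_ne_zero_iff_lt.1 this
  have hnle : ¬ (chains K Δ 2 ⊓ LinearMap.ker (bdry K)) ≤ (chains K Δ 3).map (bdry K) :=
    fun hle => absurd (Submodule.finrank_mono hle) (by omega)
  obtain ⟨z, hz, hzB⟩ := SetLike.not_le_iff_exists.1 hnle
  obtain ⟨hzC, hzK⟩ := Submodule.mem_inf.1 hz
  obtain ⟨f, hfz, hf⟩ := Submodule.exists_le_ker_of_notMem hzB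
  let g : ℕ → ℕ → K := fun x y =>
    if x < y then f (Finsupp.single {x, y} 1)
    else if y < x then -f (Finsupp.single {y, x} 1) else 0
  have glt : ∀ {x y}, x < y → g x y = f (Finsupp.single {x, y} 1) := fun hxy => by
    simp [g, hxy]
  have ganti : ∀ x y, g x y = -g y x := fun x y => by
    rcases lt_trichotomy x y with hxy | rfl | hxy
    · simp [g, hxy, hxy.not_gt]
    · simp [g]
    · simp [g, hxy, hxy.not_gt]
  have hsorted : ∀ a b c, a < b → b < c → {a, b, c} ∈ Δ → g b c - g a c + g a b = 0 := by
    intro a b c hab hbc hΔ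
    have hmem : bdry K (Finsupp.single {a, b, c} 1) ∈ (chains K Δ 3).map (bdry K) := by
      refine Submodule.mem_map_of_mem (Submodule.subset_span ⟨_, ?_, rfl⟩)
      have : ({a, b, c} : Finset ℕ).card = 3 :=
        Finset.card_eq_three.2 ⟨a, b, c, hab.ne, (hab.trans hbc).ne, hbc.ne, rfl⟩
      simp [facesOf, hΔ, this]
    have := LinearMap.mem_ker.1 (hf hmem)
    rwa [bdry_triple K hab hbc, map_add, map_sub, ← glt hab, ← glt hbc,
      ← glt (hab.trans hbc)] at this
  refine ⟨g, fun x => by simp [g], ganti, ?_, ?_⟩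
  · intro x y z hxy hyz hxz hΔ
    have perm : ∀ a b c : ℕ, ({a, b, c} : Finset ℕ) = {x, y, z} → {a, b, c} ∈ Δ :=
      fun a b c he => he ▸ hΔ
    have a1 := ganti x y
    have a2 := ganti y z
    have a3 := ganti x z
    rcases hxy.lt_or_gt with h1 | h1 <;> rcases hyz.lt_or_gt with h2 | h2 <;>
      rcases hxz.lt_or_gt with h3 | h3
    · linear_combination hsorted x y z h1 h2 hΔ + a3
    · omega
    · linear_combination -hsorted x z y h3 h2 (perm _ _ _ (by ext; simp; tauto)) + a3 + a2
    · linear_combination hsorted z x y h3 h1 (perm _ _ _ (by ext; simp; tauto)) + a2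
    · linear_combination -hsorted y x z h1 h3 (perm _ _ _ (by ext; simp; tauto)) + a1 + a3
    · linear_combination hsorted y z x h2 h3 (perm _ _ _ (by ext; simp; tauto)) + a1
    · omega
    · linear_combination -hsorted z y x h2 h1 (perm _ _ _ (by ext; simp; tauto)) + a1 + a2
  · intro p
    by_contra! hp
    have hle : chains K Δ 2 ≤ LinearMap.ker (f - vertexFunctional K p ∘ₗ bdry K) := by
      refine Submodule.span_le.2 ?_
      rintro _ ⟨F, hF, rfl⟩
      obtain ⟨a, b, hab, rfl, hΔ⟩ := exists_lt_of_mem_facesOf_two hF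
      simp only [SetLike.mem_coe, LinearMap.mem_ker, LinearMap.sub_apply, LinearMap.comp_apply]
      rw [bdry_pair K hab, map_sub, vertexFunctional_single, vertexFunctional_single, ← glt hab,
        hp a b hΔ, sub_self]
    have := LinearMap.mem_ker.1 (hle hzC)
    rw [LinearMap.sub_apply, LinearMap.comp_apply, LinearMap.mem_ker.1 hzK, map_zero,
      sub_zero] at this
    exact hfz this

/-- A complex with vanishing reduced zeroth homology has an edge across every nontrivial
bipartition of its vertices. -/
theorem exists_crossing_edge {K : Type} [Field K] {L : Finset (Finset ℕ)}
    (hdown : ∀ F ∈ L, ∀ G ⊆ F, G ∈ L) (h : betti K L 0 = 0)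
    (A : Set ℕ) {a b : ℕ} (ha : a ∈ A) (hb : b ∉ A) (haL : {a} ∈ L) (hbL : {b} ∈ L) :
    ∃ x ∈ A, ∃ y ∉ A, {x, y} ∈ L := by
  classical
  by_contra! hcon
  have h' : Module.finrank K ↥(chains K L 1 ⊓ LinearMap.ker (bdry K)) ≤
      Module.finrank K ↥((chains K L 2).map (bdry K)) := by
    have : homDim K L 1 = 0 := by simpa [betti] using h
    exact Nat.sub_eq_zero_iff_le.1 this
  have vertex : ∀ x, {x} ∈ L → Finsupp.single {x} 1 ∈ chains K L 1 := fun x hx =>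
    Submodule.subset_span ⟨_, by simp [facesOf, hx], rfl⟩
  have generators : ∀ M : Submodule K (Finset ℕ →₀ K),
      (∀ x y, {x, y} ∈ L → Finsupp.single {y} 1 - Finsupp.single {x} 1 ∈ M) →
      (chains K L 2).map (bdry K) ≤ M := by
    intro M hM
    refine Submodule.map_le_iff_le_comap.2 (Submodule.span_le.2 ?_)
    rintro _ ⟨F, hF, rfl⟩
    obtain ⟨x, y, hxy, rfl, hL⟩ := exists_lt_of_mem_facesOf_two hF
    simpa only [SetLike.mem_coe, Submodule.mem_comap, bdry_pair K hxy] using hM x y hL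
  have hle : (chains K L 2).map (bdry K) ≤ chains K L 1 ⊓ LinearMap.ker (bdry K) := by
    refine generators _ fun x y hL => ⟨Submodule.sub_mem _ (vertex _ ?_) (vertex _ ?_), ?_⟩
    · exact hdown _ hL _ (by simp)
    · exact hdown _ hL _ (by simp)
    · simp [bdry_singleton]
  have hker : (chains K L 2).map (bdry K) ≤
      LinearMap.ker (vertexFunctional K (A.indicator 1)) := by
    refine generators _ fun x y hL => ?_
    rw [LinearMap.mem_ker, map_sub, vertexFunctional_single, vertexFunctional_single]
    by_cases hx : x ∈ A <;> by_cases hy : y ∈ A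
    · simp [hx, hy]
    · exact absurd hL (hcon x hx y hy)
    · exact absurd (Finset.pair_comm x y ▸ hL) (hcon y hy x hx)
    · simp [hx, hy]
  have : FiniteDimensional K ↥(chains K L 1 ⊓ LinearMap.ker (bdry K)) :=
    Submodule.finiteDimensional_inf_left _ _
  have heq := Submodule.eq_of_le_of_finrank_le hle h'
  have hmem : Finsupp.single {a} 1 - Finsupp.single {b} 1 ∈
      chains K L 1 ⊓ LinearMap.ker (bdry K) :=
    ⟨Submodule.sub_mem _ (vertex _ haL) (vertex _ hbL), by simp [bdry_singleton]⟩
  have := hker (heq ▸ hmem)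
  rw [LinearMap.mem_ker, map_sub, vertexFunctional_single, vertexFunctional_single] at this
  simp [ha, hb] at this

theorem mem_link_singleton {Δ : Finset (Finset ℕ)} (hdown : ∀ F ∈ Δ, ∀ G ⊆ F, G ∈ Δ)
    {v : ℕ} {F : Finset ℕ} : F ∈ link Δ {v} ↔ v ∉ F ∧ F ∪ {v} ∈ Δ := by
  simp only [link, mem_filter, disjoint_singleton_right]
  exact ⟨And.right, fun h => ⟨hdown _ h.2 _ subset_union_left, h⟩⟩

/-- In a `2`-dimensional Buchsbaum complex, every nontrivial bipartition of the neighbours of a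
vertex is crossed by an edge of the link. -/
theorem exists_crossing_triangle {K : Type} [Field K] {Δ : Finset (Finset ℕ)}
    (hdown : ∀ F ∈ Δ, ∀ G ⊆ F, G ∈ Δ) (hdim : dimZ Δ = 2) (hB : IsBuchsbaum K Δ)
    (A : Set ℕ) {v a b : ℕ} (ha : a ∈ A) (hb : b ∉ A) (hav : a ≠ v) (hbv : b ≠ v)
    (haΔ : {a, v} ∈ Δ) (hbΔ : {b, v} ∈ Δ) :
    ∃ x ∈ A, ∃ y ∉ A, x ≠ v ∧ y ≠ v ∧ {x, y, v} ∈ Δ := by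
  have hv : {v} ∈ Δ := hdown _ haΔ _ (by simp)
  have hsup : Δ.sup Finset.card = 3 := by
    unfold dimZ at hdim
    omega
  obtain ⟨F, hvF, hF⟩ := Δ.exists_le_maximal hv
  have hvF' : v ∈ F := Finset.singleton_subset_iff.1 hvF
  have hcard : F.card = 3 := hsup ▸ hB.1 F hF.prop fun G hG hFG => hF.eq_of_le hG hFG
  have hlink : F.erase v ∈ link Δ {v} := by
    rw [mem_link_singleton hdown]
    refine ⟨by simp, ?_⟩
    rw [Finset.union_comm, ← Finset.insert_eq, Finset.insert_erase hvF']
    exact hF.prop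
  have hLdim : 1 ≤ dimZ (link Δ {v}) := by
    have := Finset.le_sup (f := Finset.card) hlink
    rw [Finset.card_erase_of_mem hvF', hcard] at this
    unfold dimZ
    omega
  have hLdown : ∀ F ∈ link Δ {v}, ∀ G ⊆ F, G ∈ link Δ {v} := by
    intro F hF G hGF
    rw [mem_link_singleton hdown] at hF ⊢
    exact ⟨fun h => hF.1 (hGF h), hdown _ hF.2 _ (Finset.union_subset_union_left hGF)⟩
  have hbetti : betti K (link Δ {v}) 0 = 0 := by
    have := hB.2 v hv ∅ (hLdown _ hlink _ (by simp)) 0 (by simp; omega)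
    have hempty : link (link Δ {v}) ∅ = link Δ {v} := by
      ext G
      simp [link]
    rwa [hempty] at this
  have hvert : ∀ x, x ≠ v → {x, v} ∈ Δ → {x} ∈ link Δ {v} := fun x hx hxΔ =>
    (mem_link_singleton hdown).2 ⟨by simpa using hx.symm, by simpa [← Finset.insert_eq] using hxΔ⟩
  obtain ⟨x, hx, y, hy, hxy⟩ :=
    exists_crossing_edge hLdown hbetti A ha hb (hvert a hav haΔ) (hvert b hbv hbΔ)
  obtain ⟨h1, h2⟩ := (mem_link_singleton hdown).1 hxy
  simp only [mem_insert, mem_singleton, not_or] at h1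
  refine ⟨x, hx, y, hy, Ne.symm h1.1, Ne.symm h1.2, ?_⟩
  rwa [Finset.insert_union, ← Finset.insert_eq] at h2

/-- Exactly one of the three pairs in `{x, y, z}` is an edge of `E`. -/
def oneEdge (E : Fin 6 → Fin 6 → Bool) (x y z : Fin 6) : Bool :=
  match E x y, E y z, E x z with
  | true, false, false => true
  | false, true, false => true
  | false, false, true => true
  | _, _, _ => false

/-- Every pair between `{a, a'}` and the remaining vertices other than `y` forms
with `y` a triple with exactly one edge of `E`. -/
def splits (E : Fin 6 → Fin 6 → Bool) (y a a' : Fin 6) : Bool :=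
  y != a && (y != a' && (List.finRange 6).all fun b =>
    b == y || (b == a || (b == a' || (oneEdge E y a b && oneEdge E y a' b))))

/-- The sorted triples in `Fin 6`. -/
def triples : List (Fin 6 × Fin 6 × Fin 6) :=
  [(0, 1, 2), (0, 1, 3), (0, 1, 4), (0, 1, 5), (0, 2, 3), (0, 2, 4), (0, 2, 5), (0, 3, 4),
    (0, 3, 5), (0, 4, 5), (1, 2, 3), (1, 2, 4), (1, 2, 5), (1, 3, 4), (1, 3, 5), (1, 4, 5),
    (2, 3, 4), (2, 3, 5), (2, 4, 5), (3, 4, 5)]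

/-- The graph on `Fin 6` with isolated vertex `0` and prescribed edges among `1, …, 5`. -/
def graphOf (a b c d e f g h i j : Bool) (x y : Fin 6) : Bool :=
  match x, y with
  | 1, 2 | 2, 1 => a
  | 1, 3 | 3, 1 => b
  | 1, 4 | 4, 1 => c
  | 1, 5 | 5, 1 => d
  | 2, 3 | 3, 2 => e
  | 2, 4 | 4, 2 => f
  | 2, 5 | 5, 2 => g
  | 3, 4 | 4, 3 => h
  | 3, 5 | 5, 3 => i
  | 4, 5 | 5, 4 => j
  | _, _ => false

theorem graphOf_dichotomy : ∀ a b c d e f g h i j : Bool,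
    ((!(a || b || c || d || e || f || g || h || i || j)) ||
      (Nat.ble 8 (triples.countP fun t => oneEdge (graphOf a b c d e f g h i j) t.1 t.2.1 t.2.2) ||
      (List.finRange 6).any fun y => (List.finRange 6).any fun p => (List.finRange 6).any fun q =>
        splits (graphOf a b c d e f g h i j) y p q)) = true := by
  decide +kernel

theorem eq_graphOf {E : Fin 6 → Fin 6 → Bool} (h0 : ∀ x, E 0 x = false)
    (hdiag : ∀ x, E x x = false) (hsymm : ∀ x y, E x y = E y x) :
    E = graphOf (E 1 2) (E 1 3) (E 1 4) (E 1 5) (E 2 3) (E 2 4) (E 2 5) (E 3 4) (E 3 5)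
      (E 4 5) := by
  funext x y
  fin_cases x <;> fin_cases y <;> first
    | rfl
    | exact hsymm _ _
    | exact h0 _
    | exact hdiag _
    | exact (hsymm _ _).trans (h0 _)

/-- The triples with exactly one edge of a nonempty graph with an isolated vertex are numerous, or
contain all triples through a vertex crossing a bipartition of the other vertices. -/
theorem oneEdge_dichotomy {E : Fin 6 → Fin 6 → Bool} (h0 : ∀ x, E 0 x = false)
    (hdiag : ∀ x, E x x = false) (hsymm : ∀ x y, E x y = E y x) (hne : ∃ x y, E x y = true) :
    8 ≤ (triples.filter fun t => oneEdge E t.1 t.2.1 t.2.2).length ∨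
      ∃ y p q, splits E y p q = true := by
  have hE := eq_graphOf h0 hdiag hsymm
  have key := graphOf_dichotomy (E 1 2) (E 1 3) (E 1 4) (E 1 5) (E 2 3) (E 2 4) (E 2 5) (E 3 4)
    (E 3 5) (E 4 5)
  rw [← hE, Bool.or_eq_true, Bool.or_eq_true] at key
  rcases key with key | key | key
  · obtain ⟨x, y, hxy⟩ := hne
    simp only [Bool.not_eq_true', Bool.or_eq_false_iff] at key
    obtain ⟨⟨⟨⟨⟨⟨⟨⟨⟨k1, k2⟩, k3⟩, k4⟩, k5⟩, k6⟩, k7⟩, k8⟩, k9⟩, k10⟩ := key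
    rw [hE, k1, k2, k3, k4, k5, k6, k7, k8, k9, k10] at hxy
    exfalso
    revert x y
    decide
  · left
    rw [← List.countP_eq_length_filter]
    exact Nat.le_of_ble_eq_true key
  · right
    simp only [List.any_eq_true] at key
    obtain ⟨y, -, p, -, q, -, h⟩ := key
    exact ⟨y, p, q, h⟩

/-- The vertex set in `{1, …, 6}` of a triple in `Fin 6`. -/
def tripleSet (t : Fin 6 × Fin 6 × Fin 6) : Finset ℕ :=
  {(t.1 : ℕ) + 1, (t.2.1 : ℕ) + 1, (t.2.2 : ℕ) + 1}

theorem oneEdge_decide_ne_zero {K : Type} [Field K] [DecidableEq K] {c : ℕ → ℕ → K} {x y z : Fin 6}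
    (hc : c (x + 1) (y + 1) + c (y + 1) (z + 1) - c (x + 1) (z + 1) = 0) :
    oneEdge (fun i j => decide (c (i + 1) (j + 1) ≠ 0)) x y z = false := by
  by_cases h1 : c (x + 1) (y + 1) = 0 <;> by_cases h2 : c (y + 1) (z + 1) = 0 <;>
    by_cases h3 : c (x + 1) (z + 1) = 0 <;> simp_all [oneEdge]

theorem faces_of_hVector {n : ℕ} {Δ : Finset (Finset ℕ)} (hΔ : IsComplexOn n Δ)
    (hh : hVector3 Δ 1 3 6 3) :
    n = 6 ∧ (∀ x ∈ Finset.Icc 1 6, ∀ y ∈ Finset.Icc 1 6, x ≠ y → {x, y} ∈ Δ) ∧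
      (Finset.powersetCard 3 (Finset.Icc 1 6) \ facesOf Δ 3).card = 7 := by
  obtain ⟨-, hin, hvert⟩ := hΔ
  obtain ⟨-, h1, h2, h3⟩ := hh
  simp only [hVec, Finset.sum_range_succ, Finset.sum_range_zero, fVec] at h1 h2 h3
  norm_num [Nat.choose] at h1 h2 h3
  have c1 : (facesOf Δ 1).card = 6 := by omega
  have c2 : (facesOf Δ 2).card = 15 := by omega
  have c3 : (facesOf Δ 3).card = 13 := by omega
  have hsub : ∀ m, facesOf Δ m ⊆ Finset.powersetCard m (Finset.Icc 1 n) := fun m F hF => by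
    obtain ⟨hF, hc⟩ := Finset.mem_filter.1 hF
    exact Finset.mem_powersetCard.2 ⟨hin F hF, hc⟩
  have hn : n = 6 := by
    have : facesOf Δ 1 = Finset.powersetCard 1 (Finset.Icc 1 n) := by
      refine (hsub 1).antisymm fun F hF => ?_
      obtain ⟨hF, hc⟩ := Finset.mem_powersetCard.1 hF
      obtain ⟨a, rfl⟩ := Finset.card_eq_one.1 hc
      exact Finset.mem_filter.2 ⟨hvert a (by simpa using hF), rfl⟩
    rw [this, Finset.card_powersetCard, Nat.card_Icc] at c1
    simpa using c1
  subst hn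
  refine ⟨rfl, fun x hx y hy hxy => ?_, ?_⟩
  · have : facesOf Δ 2 = Finset.powersetCard 2 (Finset.Icc 1 6) :=
      Finset.eq_of_subset_of_card_le (hsub 2) (by rw [c2, Finset.card_powersetCard]; decide)
    have hmem : {x, y} ∈ facesOf Δ 2 := by
      rw [this, Finset.mem_powersetCard]
      exact ⟨Finset.insert_subset hx (Finset.singleton_subset_iff.2 hy), Finset.card_pair hxy⟩
    exact (Finset.mem_filter.1 hmem).1
  · rw [Finset.card_sdiff_of_subset (hsub 3), c3, Finset.card_powersetCard]
    decide

theorem nodup_tripleSet : (triples.map tripleSet).Nodup := by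
  decide +kernel

/-- **Proposition 4.1.** There is no `2`-dimensional connected Buchsbaum complex `Δ`
with `β₁(Δ) = 1`, `β₂(Δ) = 4` and `h(Δ) = (1,3,6,3)`. -/
theorem stmt18 (K : Type) [Field K] :
    ¬ ∃ (n : ℕ) (Δ : Finset (Finset ℕ)), IsComplexOn n Δ ∧ dimZ Δ = 2 ∧
      IsConnectedComplex Δ ∧ IsBuchsbaum K Δ ∧
      betti K Δ 1 = 1 ∧ betti K Δ 2 = 4 ∧ hVector3 Δ 1 3 6 3 := by
  classical
  rintro ⟨n, Δ, hΔ, hdim, -, hB, hb1, -, hh⟩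
  obtain ⟨rfl, hpair, hmiss⟩ := faces_of_hVector hΔ hh
  obtain ⟨hdown, hin, -⟩ := hΔ
  obtain ⟨g, gdiag, ganti, gtri, gne⟩ := exists_cocycle (K := K) (Δ := Δ) (by simp [hb1])
  let c : ℕ → ℕ → K := fun x y => g 1 x + g x y + g y 1
  have ctri : ∀ x y z, x ≠ y → y ≠ z → x ≠ z → {x, y, z} ∈ Δ → c x y + c y z - c x z = 0 := by
    intro x y z hxy hyz hxz h
    linear_combination gtri x y z hxy hyz hxz h + ganti 1 y - ganti x z
  let E : Fin 6 → Fin 6 → Bool := fun i j => decide (c (i + 1) (j + 1) ≠ 0)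
  have hE : ∀ x y z : Fin 6, x ≠ y → y ≠ z → x ≠ z → oneEdge E x y z = true →
      tripleSet (x, y, z) ∉ Δ := by
    intro x y z hxy hyz hxz h hmem
    have := oneEdge_decide_ne_zero (ctri (x + 1) (y + 1) (z + 1) (by omega) (by omega) (by omega)
      hmem)
    exact absurd h (by simpa [E] using this)
  have lift : ∀ x ∈ Finset.Icc 1 6, ∃ i : Fin 6, (i : ℕ) + 1 = x := fun x hx => by
    rw [Finset.mem_Icc] at hx
    exact ⟨⟨x - 1, by omega⟩, by simp; omega⟩
  have hIcc : ∀ i : Fin 6, (i : ℕ) + 1 ∈ Finset.Icc 1 6 := fun i => by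
    rw [Finset.mem_Icc]
    omega
  have h0 : ∀ x, E 0 x = false := fun x => by
    have : c 1 (x + 1) = 0 := by linear_combination gdiag 1 + ganti 1 (x + 1)
    simpa [E] using this
  have hdiag : ∀ x, E x x = false := fun x => by
    have : c (x + 1) (x + 1) = 0 := by linear_combination gdiag (x + 1) + ganti 1 (x + 1)
    simpa [E] using this
  have hsymm : ∀ x y, E x y = E y x := fun x y => by
    have : c (x + 1) (y + 1) = -c (y + 1) (x + 1) := by
      linear_combination ganti 1 (x + 1) + ganti (x + 1) (y + 1) + ganti (y + 1) 1
    simp [E, this]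
  have hne : ∃ x y, E x y = true := by
    obtain ⟨x, y, hxy, hg⟩ := gne (g 1)
    obtain ⟨i, rfl⟩ := lift x (hin _ hxy _ (by simp))
    obtain ⟨j, rfl⟩ := lift y (hin _ hxy _ (by simp))
    refine ⟨i, j, decide_eq_true fun h => hg ?_⟩
    linear_combination h - ganti (j + 1) 1
  rcases oneEdge_dichotomy h0 hdiag hsymm hne with hlen | ⟨v, p, q, hs⟩
  · set l := triples.filter fun t => oneEdge E t.1 t.2.1 t.2.2
    have hnodup : (l.map tripleSet).Nodup :=
      List.Nodup.sublist (List.filter_sublist.map _) nodup_tripleSet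
    have hsub : (l.map tripleSet).toFinset ⊆
        Finset.powersetCard 3 (Finset.Icc 1 6) \ facesOf Δ 3 := by
      intro F hF
      obtain ⟨⟨x, y, z⟩, ht, rfl⟩ := List.mem_map.1 (List.mem_toFinset.1 hF)
      obtain ⟨ht, ho⟩ := List.mem_filter.1 ht
      have hsorted : ∀ t ∈ triples, t.1 < t.2.1 ∧ t.2.1 < t.2.2 := by decide +kernel
      obtain ⟨hxy, hyz⟩ := hsorted _ ht
      simp only at hxy hyz ho
      have hnot := hE x y z hxy.ne hyz.ne (hxy.trans hyz).ne ho
      refine Finset.mem_sdiff.2 ⟨Finset.mem_powersetCard.2 ⟨?_, ?_⟩, fun h =>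
        hnot (Finset.mem_filter.1 h).1⟩
      · simp only [tripleSet, Finset.insert_subset_iff, Finset.singleton_subset_iff, hIcc,
          and_self]
      · exact Finset.card_eq_three.2 ⟨_, _, _, by simp; omega, by simp; omega, by simp; omega, rfl⟩
    have := Finset.card_le_card hsub
    rw [List.toFinset_card_of_nodup hnodup, List.length_map, hmiss] at this
    omega
  · simp only [splits, Bool.and_eq_true, bne_iff_ne, List.all_eq_true, List.mem_finRange,
      Bool.or_eq_true, beq_iff_eq, forall_const] at hs
    obtain ⟨hp, hq, hs⟩ := hs
    obtain ⟨b, hbv, hbp, hbq⟩ : ∃ b, b ≠ v ∧ b ≠ p ∧ b ≠ q := by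
      clear hs hp hq
      revert v p q
      decide
    obtain ⟨x, hx, y, hy, hxv, hyv, hmem⟩ := exists_crossing_triangle hdown hdim hB
      {(p : ℕ) + 1, (q : ℕ) + 1} (v := v + 1) (a := p + 1) (b := b + 1) (by simp)
      (by simp; omega) (by omega) (by omega) (hpair _ (hIcc _) _ (hIcc _) (by omega))
      (hpair _ (hIcc _) _ (hIcc _) (by omega))
    obtain ⟨w, rfl⟩ := lift y (hin _ hmem _ (by simp))
    simp only [Set.mem_insert_iff, Set.mem_singleton_iff, not_or] at hx hy
    have hw := hs w
    have hrot : ∀ r : Fin 6, ({(r : ℕ) + 1, (w : ℕ) + 1, (v : ℕ) + 1} : Finset ℕ) =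
        tripleSet (v, r, w) := fun r => by
      ext
      simp [tripleSet]
      tauto
    rcases hw with hw | hw | hw | ⟨hw1, hw2⟩
    · omega
    · omega
    · omega
    · rcases hx with rfl | rfl
      · exact hE v p w hp (by omega) (by omega) hw1 (hrot p ▸ hmem)
      · exact hE v q w hq (by omega) (by omega) hw2 (hrot q ▸ hmem)
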